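/- If ρ ∈ L¹(ℝ³) ∩ L^p(ℝ³) for some p > 3, then the Newtonian potential Bρ is continuously differentiable on ℝ³. -/

import Mathlib

open MeasureTheory Filter Set Topology

noncomputable section

abbrev R3 : Type := EuclideanSpace ℝ (Fin 3)

/-- The Newtonian potential `Bρ(x) = ∫ ρ(y)/|x-y| dy` over all of `ℝ³`. -/
def Bfull (ρ : R3 → ℝ) (x : R3) : ℝ := ∫ y, ρ y / ‖x - y‖

/-! ### A `C¹` truncation of the Newtonian kernel -/

/-- The Newtonian kernel as a function of `s = ‖z‖ ^ 2`, replaced below `a ^ 2` by its tangent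
line at `a ^ 2`. -/
def truncInvSqrt (a s : ℝ) : ℝ :=
  (3 * max a (√s) ^ 2 - s) / (2 * max a (√s) ^ 3)

/-- The Newtonian kernel, truncated at radius `a`. -/
def truncKernel (a : ℝ) (z : R3) : ℝ := truncInvSqrt a (‖z‖ ^ 2)

/-- The derivative of the Newtonian kernel truncated at radius `a`. -/
def truncKernelDeriv (a : ℝ) (z : R3) : R3 →L[ℝ] ℝ :=
  (-(max a ‖z‖ ^ 3)⁻¹) • innerSL ℝ z

/-- The function `‖z‖⁻²`, restricted to the ball of radius `a`. -/
def ballInvSq (a : ℝ) : R3 → ℝ := (Metric.ball 0 a).indicator fun z => (‖z‖ ^ 2)⁻¹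

lemma truncInvSqrt_of_le {a s : ℝ} (ha : 0 ≤ a) (hs : s ≤ a ^ 2) :
    truncInvSqrt a s = (3 * a ^ 2 - s) / (2 * a ^ 3) := by
  rw [truncInvSqrt, max_eq_left (Real.sqrt_le_iff.2 ⟨ha, hs⟩)]

lemma truncInvSqrt_of_ge {a s : ℝ} (hs : a ^ 2 ≤ s) :
    truncInvSqrt a s = (√s)⁻¹ := by
  have hs0 : 0 ≤ s := (sq_nonneg a).trans hs
  rw [truncInvSqrt, max_eq_right (Real.le_sqrt_of_sq_le hs)]
  rcases hs0.eq_or_lt with rfl | h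
  · simp
  have h1 : 0 < √s := Real.sqrt_pos.2 h
  have h2 : √s ^ 2 = s := Real.sq_sqrt hs0
  field_simp
  nlinarith

lemma hasDerivAt_truncInvSqrt {a : ℝ} (ha : 0 < a) (s : ℝ) :
    HasDerivAt (truncInvSqrt a) (-(2 * max a (√s) ^ 3)⁻¹) s := by
  have hle : s ≤ a ^ 2 →
      HasDerivWithinAt (truncInvSqrt a) (-(2 * max a (√s) ^ 3)⁻¹) (Iic (a ^ 2)) s := by
    intro hs
    rw [max_eq_left (Real.sqrt_le_iff.2 ⟨ha.le, hs⟩)]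
    have h : HasDerivAt (fun s : ℝ => (3 * a ^ 2 - s) / (2 * a ^ 3)) (-(2 * a ^ 3)⁻¹) s := by
      exact (((hasDerivAt_id' s).const_sub (3 * a ^ 2)).div_const (2 * a ^ 3)).congr_deriv
        (by rw [neg_div, one_div])
    exact h.hasDerivWithinAt.congr (fun t ht => truncInvSqrt_of_le ha.le ht)
      (truncInvSqrt_of_le ha.le hs)
  have hge : a ^ 2 ≤ s →
      HasDerivWithinAt (truncInvSqrt a) (-(2 * max a (√s) ^ 3)⁻¹) (Ici (a ^ 2)) s := by
    intro hs
    rw [max_eq_right (Real.le_sqrt_of_sq_le hs)]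
    have hs0 : 0 < s := (pow_pos ha 2).trans_le hs
    have h1 : 0 < √s := Real.sqrt_pos.2 hs0
    have h : HasDerivAt (fun s : ℝ => (√s)⁻¹) (-(2 * √s ^ 3)⁻¹) s := by
      refine ((Real.hasDerivAt_sqrt hs0.ne').inv h1.ne').congr_deriv ?_
      field_simp
    exact h.hasDerivWithinAt.congr (fun t ht => truncInvSqrt_of_ge ht)
      (truncInvSqrt_of_ge hs)
  rcases lt_trichotomy s (a ^ 2) with hs | hs | hs
  · exact (hle hs.le).hasDerivAt (Iic_mem_nhds hs)
  · have h := (hle hs.le).union (hge hs.ge)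
    rwa [Iic_union_Ici, hasDerivWithinAt_univ] at h
  · exact (hge hs.le).hasDerivAt (Ici_mem_nhds hs)

lemma hasFDerivAt_truncKernel {a : ℝ} (ha : 0 < a) (z : R3) :
    HasFDerivAt (truncKernel a) (truncKernelDeriv a z) z := by
  have h := (hasDerivAt_truncInvSqrt ha (‖z‖ ^ 2)).comp_hasFDerivAt z
    (hasStrictFDerivAt_norm_sq z).hasFDerivAt
  rw [Real.sqrt_sq (norm_nonneg z)] at h
  convert! h using 1
  ext w
  simp [truncKernelDeriv]
  ring

lemma truncKernel_of_le {a : ℝ} (ha : 0 ≤ a) {z : R3} (hz : a ≤ ‖z‖) :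
    truncKernel a z = ‖z‖⁻¹ := by
  rw [truncKernel, truncInvSqrt_of_ge (by gcongr), Real.sqrt_sq (norm_nonneg z)]

lemma abs_truncKernel_le (a : ℝ) {z : R3} (hz : z ≠ 0) :
    |truncKernel a z| ≤ ‖z‖⁻¹ := by
  have hz0 : 0 < ‖z‖ := norm_pos_iff.2 hz
  rw [truncKernel, truncInvSqrt, Real.sqrt_sq hz0.le]
  have hm : ‖z‖ ≤ max a ‖z‖ := le_max_right _ _
  generalize max a ‖z‖ = m at hm
  generalize ‖z‖ = r at hz0 hm
  have hm0 : 0 < m := hz0.trans_le hm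
  rw [abs_of_nonneg (div_nonneg (by nlinarith) (by positivity)), ← one_div,
    div_le_div_iff₀ (by positivity) hz0]
  nlinarith [mul_nonneg (sq_nonneg (m - r)) (by linarith : 0 ≤ r + 2 * m)]

lemma norm_truncKernelDeriv (a : ℝ) (z : R3) :
    ‖truncKernelDeriv a z‖ = (|max a ‖z‖| ^ 3)⁻¹ * ‖z‖ := by
  rw [truncKernelDeriv, norm_smul, innerSL_apply_norm]
  simp

lemma norm_truncKernelDeriv_le (a : ℝ) (z : R3) :
    ‖truncKernelDeriv a z‖ ≤ (‖z‖ ^ 2)⁻¹ := by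
  rw [norm_truncKernelDeriv]
  rcases eq_or_ne z 0 with rfl | hz
  · simp
  have hz0 : 0 < ‖z‖ := norm_pos_iff.2 hz
  calc (|max a ‖z‖| ^ 3)⁻¹ * ‖z‖ ≤ (‖z‖ ^ 3)⁻¹ * ‖z‖ := by
        gcongr
        exact (le_max_right _ _).trans (le_abs_self _)
    _ = (‖z‖ ^ 2)⁻¹ := by field_simp

lemma norm_truncKernelDeriv_le_const {a : ℝ} (ha : 0 < a) (z : R3) :
    ‖truncKernelDeriv a z‖ ≤ (a ^ 2)⁻¹ := by
  rw [norm_truncKernelDeriv]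
  have h1 : a ≤ max a ‖z‖ := le_max_left _ _
  have h2 : ‖z‖ ≤ max a ‖z‖ := le_max_right _ _
  generalize max a ‖z‖ = m at h1 h2
  have hm : 0 < m := ha.trans_le h1
  rw [abs_of_pos hm]
  calc (m ^ 3)⁻¹ * ‖z‖ ≤ (m ^ 3)⁻¹ * m := by gcongr
    _ = (m ^ 2)⁻¹ := by field_simp
    _ ≤ (a ^ 2)⁻¹ := by gcongr

lemma norm_truncKernelDeriv_sub_le (a : ℝ) (z : R3) :
    ‖truncKernelDeriv 0 z - truncKernelDeriv a z‖ ≤ 2 * ballInvSq a z := by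
  by_cases hz : z ∈ Metric.ball (0 : R3) a
  · rw [ballInvSq, indicator_of_mem hz]
    linarith [norm_sub_le (truncKernelDeriv 0 z) (truncKernelDeriv a z),
      norm_truncKernelDeriv_le 0 z, norm_truncKernelDeriv_le a z]
  · have h : a ≤ ‖z‖ := by simpa using hz
    rw [ballInvSq, indicator_of_notMem hz, truncKernelDeriv, truncKernelDeriv,
      max_eq_right h, max_eq_right (norm_nonneg z)]
    simp

lemma continuous_truncKernelDeriv {a : ℝ} (ha : 0 < a) : Continuous (truncKernelDeriv a) := by
  have h (z : R3) : max a ‖z‖ ^ 3 ≠ 0 := (pow_pos (ha.trans_le (le_max_left _ _)) 3).ne'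
  exact ((((continuous_const.max continuous_norm).pow 3).inv₀ h).neg).smul
    (innerSL ℝ).continuous

lemma stronglyMeasurable_truncKernelDeriv (a : ℝ) :
    StronglyMeasurable (truncKernelDeriv a) := by
  have h : Measurable fun z : R3 => -(max a ‖z‖ ^ 3)⁻¹ := by fun_prop
  exact h.stronglyMeasurable.smul (innerSL ℝ).continuous.stronglyMeasurable

lemma measurable_truncKernel (a : ℝ) : Measurable (truncKernel a) := by
  unfold truncKernel truncInvSqrt
  fun_prop

/-! ### Integrability of the dominating functions -/

lemma ballInvSq_nonneg (a : ℝ) (z : R3) : 0 ≤ ballInvSq a z :=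
  indicator_nonneg (fun _ _ => by positivity) z

lemma measurable_ballInvSq (a : ℝ) : Measurable (ballInvSq a) := by
  unfold ballInvSq
  exact Measurable.indicator (by fun_prop) measurableSet_ball

lemma inv_sq_le_one_add_ballInvSq (z : R3) : (‖z‖ ^ 2)⁻¹ ≤ 1 + ballInvSq 1 z := by
  by_cases hz : z ∈ Metric.ball (0 : R3) 1
  · rw [ballInvSq, indicator_of_mem hz]
    linarith
  · have h : 1 ≤ ‖z‖ := by simpa using hz
    rw [ballInvSq, indicator_of_notMem hz, add_zero]
    exact inv_le_one_of_one_le₀ (one_le_pow₀ h)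

lemma inv_norm_le_one_add_ballInvSq (z : R3) : ‖z‖⁻¹ ≤ 1 + ballInvSq 1 z := by
  by_cases hz : z ∈ Metric.ball (0 : R3) 1
  · rw [ballInvSq, indicator_of_mem hz, ← inv_pow]
    nlinarith [sq_nonneg (‖z‖⁻¹ - 1)]
  · have h : 1 ≤ ‖z‖ := by simpa using hz
    rw [ballInvSq, indicator_of_notMem hz, add_zero]
    exact inv_le_one_of_one_le₀ h

lemma ballInvSq_rpow {a q : ℝ} (hq : 0 < q) :
    (fun z => ballInvSq a z ^ q) =
      (Metric.ball (0 : R3) a).indicator fun z => ((‖z‖ ^ 2)⁻¹) ^ q := by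
  ext z
  by_cases hz : z ∈ Metric.ball (0 : R3) a
  · rw [ballInvSq, indicator_of_mem hz, indicator_of_mem hz]
  · rw [ballInvSq, indicator_of_notMem hz, indicator_of_notMem hz, Real.zero_rpow hq.ne']

lemma integrableOn_inv_sq_rpow {a q : ℝ} (hq : q < 3 / 2) :
    IntegrableOn (fun z : R3 => ((‖z‖ ^ 2)⁻¹) ^ q) (Metric.ball 0 a) := by
  refine integrableOn_ball_of_norm_le_rpow (C := 1) (α := 2 * q) (by simp) ?_ ?_ ?_
  · simp
    linarith
  · refine Eventually.of_forall fun z => ?_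
    rw [Real.norm_of_nonneg (by positivity), one_mul, Real.inv_rpow (by positivity),
      Real.rpow_neg (norm_nonneg z), Real.rpow_mul (norm_nonneg z), Real.rpow_two]
  · exact Measurable.aestronglyMeasurable (by fun_prop)

lemma memLp_ballInvSq {a q : ℝ} (hq0 : 0 < q) (hq : q < 3 / 2) :
    MemLp (ballInvSq a) (ENNReal.ofReal q) := by
  rw [← integrable_norm_rpow_iff (measurable_ballInvSq a).aestronglyMeasurable
    (by simpa using hq0) ENNReal.ofReal_ne_top, ENNReal.toReal_ofReal hq0.le]
  simp_rw [Real.norm_of_nonneg (ballInvSq_nonneg a _)]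
  rw [ballInvSq_rpow hq0, integrable_indicator_iff measurableSet_ball]
  exact integrableOn_inv_sq_rpow hq

lemma tendsto_integral_ballInvSq_rpow {q : ℝ} (hq0 : 0 < q) (hq : q < 3 / 2) {a : ℕ → ℝ}
    (ha1 : ∀ n, a n ≤ 1) (ha : Tendsto a atTop (𝓝 0)) :
    Tendsto (fun n => ∫ z, ballInvSq (a n) z ^ q) atTop (𝓝 0) := by
  have h (n : ℕ) : ∫ z, ballInvSq (a n) z ^ q =
      ∫ z, (Metric.ball (0 : R3) (a n)).indicator (fun z => ((‖z‖ ^ 2)⁻¹) ^ q) z := by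
    rw [← ballInvSq_rpow hq0]
  simp_rw [h]
  rw [← integral_zero R3 ℝ (μ := volume)]
  refine tendsto_integral_of_dominated_convergence
    ((Metric.ball (0 : R3) 1).indicator fun z => ((‖z‖ ^ 2)⁻¹) ^ q) ?_ ?_ ?_ ?_
  · exact fun n => (Measurable.indicator (by fun_prop) measurableSet_ball).aestronglyMeasurable
  · rw [integrable_indicator_iff measurableSet_ball]
    exact integrableOn_inv_sq_rpow hq
  · refine fun n => Eventually.of_forall fun z => ?_
    rw [Real.norm_of_nonneg (indicator_nonneg (fun _ _ => by positivity) z)]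
    exact indicator_le_indicator_of_subset (Metric.ball_subset_ball (ha1 n))
      (fun _ => by positivity) z
  · filter_upwards [Measure.ae_ne volume (0 : R3)] with z hz
    refine tendsto_const_nhds.congr' ?_
    filter_upwards [ha.eventually_lt_const (norm_pos_iff.2 hz)] with n hn
    rw [indicator_of_notMem]
    simpa using hn.le

/-! ### The potential as a uniform limit of truncated potentials -/

lemma memLp_abs {p : ℝ} (hp : 0 < p) {ρ : R3 → ℝ} (h1 : Integrable ρ)
    (hp' : Integrable (fun x => |ρ x| ^ p)) : MemLp (fun y => |ρ y|) (ENNReal.ofReal p) := by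
  rw [← integrable_norm_rpow_iff h1.abs.aestronglyMeasurable
    (by simpa using hp) ENNReal.ofReal_ne_top, ENNReal.toReal_ofReal hp.le]
  simpa using hp'

section

variable {p q : ℝ} {ρ : R3 → ℝ}

lemma integrable_abs_mul_ballInvSq (hpq : p.HolderConjugate q) (hq : q < 3 / 2)
    (h1 : Integrable ρ) (hp' : Integrable (fun x => |ρ x| ^ p)) (a : ℝ) (x : R3) :
    Integrable (fun y => |ρ y| * ballInvSq a (x - y)) := by
  have := hpq.ennrealOfReal
  exact (memLp_abs hpq.pos h1 hp').integrable_mul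
    ((memLp_ballInvSq hpq.symm.pos hq).comp_measurePreserving
      (Measure.measurePreserving_sub_left volume x))

lemma integrable_abs_mul_one_add_ballInvSq (hpq : p.HolderConjugate q) (hq : q < 3 / 2)
    (h1 : Integrable ρ) (hp' : Integrable (fun x => |ρ x| ^ p)) (a : ℝ) (x : R3) :
    Integrable (fun y => |ρ y| * (1 + ballInvSq a (x - y))) := by
  simp_rw [mul_add, mul_one]
  exact h1.abs.add (integrable_abs_mul_ballInvSq hpq hq h1 hp' a x)

lemma integral_abs_mul_ballInvSq_le (hpq : p.HolderConjugate q) (hq : q < 3 / 2)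
    (h1 : Integrable ρ) (hp' : Integrable (fun x => |ρ x| ^ p)) (a : ℝ) (x : R3) :
    ∫ y, |ρ y| * ballInvSq a (x - y) ≤
      (∫ y, |ρ y| ^ p) ^ (1 / p) * (∫ z, ballInvSq a z ^ q) ^ (1 / q) := by
  have h := integral_mul_le_Lp_mul_Lq_of_nonneg hpq
    (Eventually.of_forall fun y => abs_nonneg (ρ y))
    (Eventually.of_forall fun y => ballInvSq_nonneg a (x - y))
    (memLp_abs hpq.pos h1 hp')
    ((memLp_ballInvSq hpq.symm.pos hq).comp_measurePreserving
      (Measure.measurePreserving_sub_left volume x))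
  rwa [integral_sub_left_eq_self (fun z => ballInvSq a z ^ q) volume x] at h

lemma aestronglyMeasurable_smul_truncKernelDeriv (h1 : Integrable ρ) (a : ℝ) (x : R3) :
    AEStronglyMeasurable (fun y => ρ y • truncKernelDeriv a (x - y)) :=
  h1.aestronglyMeasurable.smul ((stronglyMeasurable_truncKernelDeriv a).comp_measurable
    (measurable_const.sub measurable_id)).aestronglyMeasurable

lemma aestronglyMeasurable_mul_truncKernel (h1 : Integrable ρ) (a : ℝ) (x : R3) :
    AEStronglyMeasurable (fun y => ρ y * truncKernel a (x - y)) :=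
  h1.aestronglyMeasurable.mul ((measurable_truncKernel a).comp
    (measurable_const.sub measurable_id)).aestronglyMeasurable

lemma integrable_smul_truncKernelDeriv (hpq : p.HolderConjugate q) (hq : q < 3 / 2)
    (h1 : Integrable ρ) (hp' : Integrable (fun x => |ρ x| ^ p)) (a : ℝ) (x : R3) :
    Integrable (fun y => ρ y • truncKernelDeriv a (x - y)) := by
  refine (integrable_abs_mul_one_add_ballInvSq hpq hq h1 hp' 1 x).mono'
    (aestronglyMeasurable_smul_truncKernelDeriv h1 a x) (Eventually.of_forall fun y => ?_)
  rw [norm_smul, Real.norm_eq_abs]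
  gcongr
  exact (norm_truncKernelDeriv_le a _).trans (inv_sq_le_one_add_ballInvSq _)

lemma norm_mul_truncKernel_le (a : ℝ) (x : R3) :
    ∀ᵐ y, ‖ρ y * truncKernel a (x - y)‖ ≤ |ρ y| * (1 + ballInvSq 1 (x - y)) := by
  filter_upwards [Measure.ae_ne volume x] with y hy
  rw [norm_mul, Real.norm_eq_abs, Real.norm_eq_abs]
  gcongr
  exact (abs_truncKernel_le a (sub_ne_zero.2 hy.symm)).trans (inv_norm_le_one_add_ballInvSq _)

lemma hasFDerivAt_integral_truncKernel (hpq : p.HolderConjugate q) (hq : q < 3 / 2)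
    (h1 : Integrable ρ) (hp' : Integrable (fun x => |ρ x| ^ p)) {a : ℝ} (ha : 0 < a) (x : R3) :
    HasFDerivAt (fun x => ∫ y, ρ y * truncKernel a (x - y))
      (∫ y, ρ y • truncKernelDeriv a (x - y)) x := by
  refine hasFDerivAt_integral_of_dominated_of_fderiv_le
    (F' := fun x y => ρ y • truncKernelDeriv a (x - y))
    (bound := fun y => |ρ y| * (a ^ 2)⁻¹) univ_mem
    (Eventually.of_forall fun x => aestronglyMeasurable_mul_truncKernel h1 a x)
    ((integrable_abs_mul_one_add_ballInvSq hpq hq h1 hp' 1 x).mono'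
      (aestronglyMeasurable_mul_truncKernel h1 a x) (norm_mul_truncKernel_le a x))
    (aestronglyMeasurable_smul_truncKernelDeriv h1 a x)
    (Eventually.of_forall fun y x _ => ?_) (h1.abs.mul_const _)
    (Eventually.of_forall fun y x _ => ?_)
  · rw [norm_smul, Real.norm_eq_abs]
    gcongr
    exact norm_truncKernelDeriv_le_const ha _
  · exact ((hasFDerivAt_truncKernel ha (x - y)).comp x
      ((hasFDerivAt_id x).sub_const y)).const_mul (ρ y)

lemma continuous_integral_truncKernelDeriv (h1 : Integrable ρ) {a : ℝ} (ha : 0 < a) :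
    Continuous fun x => ∫ y, ρ y • truncKernelDeriv a (x - y) := by
  refine continuous_of_dominated (bound := fun y => |ρ y| * (a ^ 2)⁻¹)
    (fun x => aestronglyMeasurable_smul_truncKernelDeriv h1 a x)
    (fun x => Eventually.of_forall fun y => ?_) (h1.abs.mul_const _)
    (Eventually.of_forall fun y => ?_)
  · rw [norm_smul, Real.norm_eq_abs]
    gcongr
    exact norm_truncKernelDeriv_le_const ha _
  · have h : Continuous fun x => truncKernelDeriv a (x - y) :=
      (continuous_truncKernelDeriv ha).comp (continuous_id.sub continuous_const)
    exact h.const_smul (ρ y)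

lemma tendsto_integral_truncKernel (hpq : p.HolderConjugate q) (hq : q < 3 / 2)
    (h1 : Integrable ρ) (hp' : Integrable (fun x => |ρ x| ^ p)) {a : ℕ → ℝ}
    (ha0 : ∀ n, 0 < a n) (ha : Tendsto a atTop (𝓝 0)) (x : R3) :
    Tendsto (fun n => ∫ y, ρ y * truncKernel (a n) (x - y)) atTop (𝓝 (Bfull ρ x)) := by
  refine tendsto_integral_of_dominated_convergence
    (fun y => |ρ y| * (1 + ballInvSq 1 (x - y)))
    (fun n => aestronglyMeasurable_mul_truncKernel h1 (a n) x)
    (integrable_abs_mul_one_add_ballInvSq hpq hq h1 hp' 1 x)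
    (fun n => norm_mul_truncKernel_le (a n) x) ?_
  filter_upwards [Measure.ae_ne volume x] with y hy
  refine tendsto_const_nhds.congr' ?_
  filter_upwards [ha.eventually_lt_const (norm_pos_iff.2 (sub_ne_zero.2 hy.symm))] with n hn
  rw [truncKernel_of_le (ha0 n).le hn.le, div_eq_mul_inv]

lemma tendstoUniformly_integral_truncKernelDeriv (hpq : p.HolderConjugate q) (hq : q < 3 / 2)
    (h1 : Integrable ρ) (hp' : Integrable (fun x => |ρ x| ^ p)) {a : ℕ → ℝ}
    (ha1 : ∀ n, a n ≤ 1) (ha : Tendsto a atTop (𝓝 0)) :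
    TendstoUniformly (fun n x => ∫ y, ρ y • truncKernelDeriv (a n) (x - y))
      (fun x => ∫ y, ρ y • truncKernelDeriv 0 (x - y)) atTop := by
  have hlim : Tendsto (fun n => 2 * ((∫ y, |ρ y| ^ p) ^ (1 / p) *
      (∫ z, ballInvSq (a n) z ^ q) ^ (1 / q))) atTop (𝓝 0) := by
    have h := (tendsto_integral_ballInvSq_rpow hpq.symm.pos hq ha1 ha).rpow_const
      (p := 1 / q) (Or.inr (one_div_pos.2 hpq.symm.pos).le)
    rw [Real.zero_rpow (one_div_pos.2 hpq.symm.pos).ne'] at h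
    simpa using (h.const_mul ((∫ y, |ρ y| ^ p) ^ (1 / p))).const_mul 2
  rw [Metric.tendstoUniformly_iff]
  intro ε hε
  filter_upwards [hlim.eventually_lt_const hε] with n hn x
  refine lt_of_le_of_lt ?_ hn
  rw [dist_eq_norm, ← integral_sub (integrable_smul_truncKernelDeriv hpq hq h1 hp' 0 x)
    (integrable_smul_truncKernelDeriv hpq hq h1 hp' (a n) x)]
  calc ‖∫ y, (ρ y • truncKernelDeriv 0 (x - y) - ρ y • truncKernelDeriv (a n) (x - y))‖
      ≤ ∫ y, 2 * (|ρ y| * ballInvSq (a n) (x - y)) := by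
        refine norm_integral_le_of_norm_le
          ((integrable_abs_mul_ballInvSq hpq hq h1 hp' (a n) x).const_mul 2)
          (Eventually.of_forall fun y => ?_)
        rw [← smul_sub (ρ y) (truncKernelDeriv 0 (x - y)), norm_smul, Real.norm_eq_abs, mul_left_comm]
        gcongr
        exact norm_truncKernelDeriv_sub_le (a n) _
    _ = 2 * ∫ y, |ρ y| * ballInvSq (a n) (x - y) := integral_const_mul _ _
    _ ≤ _ := by
        gcongr
        exact integral_abs_mul_ballInvSq_le hpq hq h1 hp' (a n) x

end

/-- **Lemma 3.3.** If `ρ ∈ L¹(ℝ³) ∩ Lᵖ(ℝ³)` for some `p > 3`, then the Newtonian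
potential `Bρ` is continuously differentiable. -/
theorem newtonian_potential_C1 (p : ℝ) (hp : 3 < p) (ρ : R3 → ℝ)
    (h1 : Integrable ρ) (hp' : Integrable (fun x => |ρ x| ^ p)) :
    ContDiff ℝ 1 (Bfull ρ) := by
  have hpq : p.HolderConjugate p.conjExponent := .conjExponent (by linarith)
  have hq : p.conjExponent < 3 / 2 := by
    rw [Real.conjExponent, div_lt_div_iff₀ (by linarith) (by norm_num)]
    linarith
  let a : ℕ → ℝ := fun n => 1 / ((n : ℝ) + 1)
  have ha0 (n : ℕ) : 0 < a n := Nat.one_div_pos_of_nat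
  have ha1 (n : ℕ) : a n ≤ 1 := div_le_one_of_le₀ (by simp) (by positivity)
  have ha : Tendsto a atTop (𝓝 0) := tendsto_one_div_add_atTop_nhds_zero_nat
  have hunif := tendstoUniformly_integral_truncKernelDeriv hpq hq h1 hp' ha1 ha
  exact contDiff_one_iff_hasFDerivAt.2 ⟨_,
    hunif.continuous (Frequently.of_forall fun n => continuous_integral_truncKernelDeriv h1 (ha0 n)),
    hasFDerivAt_of_tendstoUniformly hunif
      (fun n x => hasFDerivAt_integral_truncKernel hpq hq h1 hp' (ha0 n) x)
      (fun x => tendsto_integral_truncKernel hpq hq h1 hp' ha0 ha x)⟩
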